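/- Let R be an algebraic curvature tensor on ℝⁿ, let 2 ≤ p ≤ n, let I be a (p−2)-element subset of {1,…,n}, and let i, j, k, l be four distinct indices not belonging to I. Then ⟨R^p(e_i ∧ e_j ∧ e^I), e_k ∧ e_l ∧ e^I⟩ = 2·R_{ijkl}, where e^I denotes the wedge product of the e_m for m ∈ I taken in increasing order. -/

import Mathlib

open scoped BigOperators RealInnerProductSpace

noncomputable section

/-- An algebraic curvature tensor on a real module: a quadrilinear form with the
symmetries of the Riemann curvature tensor. -/
structure AlgCurv (V : Type*) [AddCommGroup V] [Module ℝ V] where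
  T : V →ₗ[ℝ] V →ₗ[ℝ] V →ₗ[ℝ] V →ₗ[ℝ] ℝ
  antisym₁ : ∀ x y z w, T x y z w = - T y x z w
  antisym₂ : ∀ x y z w, T x y z w = - T x y w z
  pairsym : ∀ x y z w, T x y z w = T z w x y
  bianchi : ∀ x y z w, T x y z w + T y z x w + T z x y w = 0

/-- Coordinates of the exterior algebra of ℝⁿ in the orthonormal basis `e^S`,
`S` ranging over subsets of `{1,…,n}`. -/
abbrev ExtCoord (n : ℕ) := Finset (Fin n) → ℝ

/-- The sign `(-1)^{#{m ∈ S : m < i}}`. -/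
def sgn {n : ℕ} (i : Fin n) (S : Finset (Fin n)) : ℝ :=
  (-1 : ℝ) ^ (S.filter fun m => m < i).card

/-- Exterior multiplication `(aⁱ)*` by `e_i`, in coordinates. -/
def wedgeE {n : ℕ} (i : Fin n) (f : ExtCoord n) : ExtCoord n :=
  fun S => if i ∈ S then sgn i S * f (S.erase i) else 0

/-- Interior multiplication `aⁱ` by `e_i`, in coordinates. -/
def contrE {n : ℕ} (i : Fin n) (f : ExtCoord n) : ExtCoord n :=
  fun S => if i ∈ S then 0 else sgn i S * f (insert i S)

/-- Weitzenböck operator built from curvature components via Witten's formula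
`R^p = Σ_{i,j,k,l} R_{ijkl} (aⁱ)* aʲ (aᵏ)* aˡ`. -/
def weitzOp {n : ℕ} (c : Fin n → Fin n → Fin n → Fin n → ℝ) (f : ExtCoord n) : ExtCoord n :=
  ∑ i, ∑ j, ∑ k, ∑ l, c i j k l • wedgeE i (contrE j (wedgeE k (contrE l f)))

/-- The standard orthonormal basis vector `e_i` of ℝⁿ. -/
def estd {n : ℕ} (i : Fin n) : EuclideanSpace ℝ (Fin n) := EuclideanSpace.single i 1

/-- The Weitzenböck curvature operator of an algebraic curvature tensor on ℝⁿ. -/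
def weitz {n : ℕ} (R : AlgCurv (EuclideanSpace ℝ (Fin n))) (f : ExtCoord n) : ExtCoord n :=
  weitzOp (fun i j k l => R.T (estd i) (estd j) (estd k) (estd l)) f

/-- The inner product on the exterior algebra making the `e^S` orthonormal. -/
def extInner {n : ℕ} (f g : ExtCoord n) : ℝ := ∑ S : Finset (Fin n), f S * g S

/-- The basis element `e^S` of the exterior algebra. -/
def eB {n : ℕ} (S : Finset (Fin n)) : ExtCoord n := fun T => if T = S then 1 else 0

/-- Sectional curvature `K(u,v) = -R(u,v,u,v)` (paper's sign convention). -/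
def sectK {V : Type*} [AddCommGroup V] [Module ℝ V] (R : AlgCurv V) (u v : V) : ℝ :=
  - R.T u v u v

/-- Wedging with a vector `x ∈ ℝⁿ`, in coordinates. -/
def wedgeV {n : ℕ} (x : EuclideanSpace ℝ (Fin n)) (f : ExtCoord n) : ExtCoord n :=
  ∑ i, x i • wedgeE i f

/-- The wedge product `u¹ ∧ … ∧ u^p` of a family of vectors. -/
def wedgeFam {n p : ℕ} (u : Fin p → EuclideanSpace ℝ (Fin n)) : ExtCoord n :=
  (List.ofFn u).foldr wedgeV (eB ∅)

/-- The sum of sectional curvatures `Σ_{i=1}^p Σ_{j=p+1}^n K(vⁱ,vʲ)`. -/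
def sumK {n : ℕ} (R : AlgCurv (EuclideanSpace ℝ (Fin n))) (p : ℕ)
    (v : Fin n → EuclideanSpace ℝ (Fin n)) : ℝ :=
  ∑ i ∈ Finset.univ.filter (fun i : Fin n => (i : ℕ) < p),
    ∑ j ∈ Finset.univ.filter (fun j : Fin n => p ≤ (j : ℕ)), sectK R (v i) (v j)

/-- The constant `D = (1/2)p(n−p) + (4/3)·binom(p,2)·binom(n−p,2)`. -/
def Dconst (n p : ℕ) : ℝ :=
  (1 : ℝ) / 2 * ((p * (n - p) : ℕ) : ℝ)
    + (4 : ℝ) / 3 * ((p.choose 2 * ((n - p).choose 2) : ℕ) : ℝ)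

/-- The pinching constant `C(n,p) = D/(1+D)`. -/
def Cnp (n p : ℕ) : ℝ := Dconst n p / (1 + Dconst n p)


section CanonicalAnticommutation

variable {n : ℕ}

lemma sgn_mul_self (a : Fin n) (S : Finset (Fin n)) : sgn a S * sgn a S = 1 := by
  simp [sgn, ← mul_pow]

lemma sgn_insert (a b : Fin n) (S : Finset (Fin n)) (h : b ∉ S) :
    sgn a (insert b S) = (if b < a then -1 else 1) * sgn a S := by
  unfold sgn
  rw [Finset.filter_insert]
  split_ifs with hb
  · rw [Finset.card_insert_of_notMem (by simp [h]), pow_succ]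
    ring
  · simp

lemma sgn_erase (a b : Fin n) (S : Finset (Fin n)) (h : b ∈ S) :
    sgn a (S.erase b) = (if b < a then -1 else 1) * sgn a S := by
  have key := sgn_insert a b (S.erase b) (Finset.notMem_erase b S)
  rw [Finset.insert_erase h] at key
  rw [key]
  split_ifs <;> ring

lemma wedgeE_wedgeE (a b : Fin n) (f : ExtCoord n) :
    wedgeE a (wedgeE b f) = -wedgeE b (wedgeE a f) := by
  funext S
  simp only [wedgeE, Pi.neg_apply, Finset.mem_erase]
  rcases lt_trichotomy a b with h | rfl | h
  · by_cases ha : a ∈ S <;> by_cases hb : b ∈ S <;>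
      simp [ha, hb, h, h.ne, h.ne', h.not_gt, sgn_erase, Finset.erase_right_comm (a := a)]
    ring
  · simp
  · by_cases ha : a ∈ S <;> by_cases hb : b ∈ S <;>
      simp [ha, hb, h, h.ne, h.ne', h.not_gt, sgn_erase, Finset.erase_right_comm (a := a)]
    ring

lemma contrE_contrE (a b : Fin n) (f : ExtCoord n) :
    contrE a (contrE b f) = -contrE b (contrE a f) := by
  funext S
  simp only [contrE, Pi.neg_apply, Finset.mem_insert]
  rcases lt_trichotomy a b with h | rfl | h
  · by_cases ha : a ∈ S <;> by_cases hb : b ∈ S <;>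
      simp [ha, hb, h, h.ne, h.ne', h.not_gt, sgn_insert, Finset.insert_comm a b]
    ring
  · simp
  · by_cases ha : a ∈ S <;> by_cases hb : b ∈ S <;>
      simp [ha, hb, h, h.ne, h.ne', h.not_gt, sgn_insert, Finset.insert_comm a b]
    ring

lemma contrE_wedgeE_self (a : Fin n) (f : ExtCoord n) :
    contrE a (wedgeE a f) = f - wedgeE a (contrE a f) := by
  funext S
  simp only [contrE, wedgeE, Pi.sub_apply]
  by_cases ha : a ∈ S
  · simp [ha, sgn_erase, Finset.insert_erase, ← mul_assoc, sgn_mul_self]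
  · simp [ha, sgn_insert, ← mul_assoc, sgn_mul_self]

lemma contrE_wedgeE_of_ne {a b : Fin n} (hab : a ≠ b) (f : ExtCoord n) :
    contrE a (wedgeE b f) = -wedgeE b (contrE a f) := by
  funext S
  simp only [contrE, wedgeE, Pi.neg_apply, Finset.mem_insert, Finset.mem_erase]
  rcases lt_or_gt_of_ne hab with h | h <;>
  · by_cases ha : a ∈ S <;> by_cases hb : b ∈ S <;>
      simp [ha, hb, h, hab, hab.symm, h.not_gt, sgn_insert, sgn_erase,
        Finset.erase_insert_of_ne hab]
    ring

lemma wedgeE_contrE_of_ne {a b : Fin n} (hab : a ≠ b) (f : ExtCoord n) :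
    wedgeE a (contrE b f) = -contrE b (wedgeE a f) := by
  rw [contrE_wedgeE_of_ne hab.symm, neg_neg]

lemma wedgeE_neg (a : Fin n) (f : ExtCoord n) : wedgeE a (-f) = -wedgeE a f := by
  funext S; simp only [wedgeE, Pi.neg_apply]; split_ifs <;> simp

lemma contrE_neg (a : Fin n) (f : ExtCoord n) : contrE a (-f) = -contrE a f := by
  funext S; simp only [contrE, Pi.neg_apply]; split_ifs <;> simp

@[simp] lemma wedgeE_zero (a : Fin n) : wedgeE a (0 : ExtCoord n) = 0 := by
  funext S; simp [wedgeE]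

@[simp] lemma contrE_zero (a : Fin n) : contrE a (0 : ExtCoord n) = 0 := by
  funext S; simp [contrE]

lemma wedgeE_wedgeE_self (a : Fin n) (f : ExtCoord n) : wedgeE a (wedgeE a f) = 0 :=
  self_eq_neg.mp (wedgeE_wedgeE a a f)

lemma contrE_eB_of_notMem {a : Fin n} {I : Finset (Fin n)} (h : a ∉ I) :
    contrE a (eB I) = 0 := by
  funext S
  have : insert a S ≠ I := fun e => h (e ▸ Finset.mem_insert_self a S)
  simp [contrE, eB, this]

lemma extInner_comm (f g : ExtCoord n) : extInner f g = extInner g f := by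
  simp only [extInner, mul_comm]

lemma extInner_neg_left (f g : ExtCoord n) : extInner (-f) g = -extInner f g := by
  simp [extInner]

@[simp] lemma extInner_zero_left (g : ExtCoord n) : extInner 0 g = 0 := by
  simp [extInner]

lemma extInner_smul_left (c : ℝ) (f g : ExtCoord n) :
    extInner (c • f) g = c * extInner f g := by
  simp [extInner, Finset.mul_sum, mul_assoc]

lemma extInner_sum_left {ι : Type*} (s : Finset ι) (f : ι → ExtCoord n) (g : ExtCoord n) :
    extInner (∑ x ∈ s, f x) g = ∑ x ∈ s, extInner (f x) g := by
  simp only [extInner, Finset.sum_apply, Finset.sum_mul]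
  exact Finset.sum_comm

lemma extInner_eB_self (I : Finset (Fin n)) : extInner (eB I) (eB I) = 1 := by
  simp [extInner, eB]

lemma extInner_wedgeE_left (a : Fin n) (f g : ExtCoord n) :
    extInner (wedgeE a f) g = extInner f (contrE a g) := by
  simp only [extInner, wedgeE, contrE, ite_mul, zero_mul, mul_ite, mul_zero]
  have flip (S : Finset (Fin n)) (r : ℝ) :
      (if a ∈ S then 0 else r) = if a ∉ S then r else 0 := (ite_not _ _ _).symm
  simp only [flip]
  rw [← Finset.sum_filter, ← Finset.sum_filter]
  refine Finset.sum_bij' (fun S _ => S.erase a) (fun S _ => insert a S) ?_ ?_ ?_ ?_ ?_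
  · simp
  · simp
  · intro S hS
    exact Finset.insert_erase (by simpa using hS)
  · intro S hS
    exact Finset.erase_insert (by simpa using hS)
  · intro S hS
    have hS : a ∈ S := by simpa using hS
    rw [Finset.insert_erase hS, sgn_erase a a S hS]
    simp
    ring

/-- A form annihilated by `e_a ∧ ·` is orthogonal to one annihilated by contraction with `e_a`. -/
lemma extInner_eq_zero_of_wedgeE_contrE {a : Fin n} {f g : ExtCoord n}
    (hf : wedgeE a f = 0) (hg : contrE a g = 0) : extInner f g = 0 := by
  have h : f = wedgeE a (contrE a f) := by
    have := contrE_wedgeE_self a f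
    rw [hf, contrE_zero] at this
    exact (sub_eq_zero.mp this.symm)
  rw [h, extInner_wedgeE_left, hg, extInner_comm, extInner_zero_left]

lemma wedgeE_quartic_eq_zero {m a b c d : Fin n} {f : ExtCoord n} (hb : m ≠ b) (hd : m ≠ d)
    (hf : wedgeE m f = 0) :
    wedgeE m (wedgeE a (contrE b (wedgeE c (contrE d f)))) = 0 := by
  rw [wedgeE_wedgeE, wedgeE_contrE_of_ne hb, wedgeE_wedgeE m c, wedgeE_contrE_of_ne hd, hf]
  simp

lemma contrE_quartic_eq_zero {m a b c d : Fin n} {f : ExtCoord n} (ha : m ≠ a) (hc : m ≠ c)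
    (hf : contrE m f = 0) :
    contrE m (wedgeE a (contrE b (wedgeE c (contrE d f)))) = 0 := by
  rw [contrE_wedgeE_of_ne ha, contrE_contrE, contrE_wedgeE_of_ne hc, contrE_contrE m d, hf]
  simp

variable {I : Finset (Fin n)} {i j : Fin n}

lemma contrE_wedgeE_eB {i : Fin n} (hi : i ∉ I) : contrE i (wedgeE i (eB I)) = eB I := by
  rw [contrE_wedgeE_self, contrE_eB_of_notMem hi, wedgeE_zero, sub_zero]

lemma contrE_wedgeE_wedgeE_eB_left (hij : i ≠ j) (hi : i ∉ I) :
    contrE i (wedgeE i (wedgeE j (eB I))) = wedgeE j (eB I) := by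
  rw [contrE_wedgeE_self, contrE_wedgeE_of_ne hij, contrE_eB_of_notMem hi]
  simp

lemma contrE_wedgeE_wedgeE_eB_of_ne {m : Fin n} (hi : m ≠ i) (hj : m ≠ j) (hm : m ∉ I) :
    contrE m (wedgeE i (wedgeE j (eB I))) = 0 := by
  rw [contrE_wedgeE_of_ne hi, contrE_wedgeE_of_ne hj, contrE_eB_of_notMem hm]
  simp

lemma wedgeE_wedgeE_wedgeE_self_left (f : ExtCoord n) :
    wedgeE i (wedgeE i (wedgeE j f)) = 0 := wedgeE_wedgeE_self i _

lemma wedgeE_wedgeE_wedgeE_self_right (f : ExtCoord n) :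
    wedgeE j (wedgeE i (wedgeE j f)) = 0 := by
  rw [wedgeE_wedgeE, wedgeE_wedgeE_self]
  simp

/-- The matrix coefficient of the quartic monomial replacing `e_i ∧ e_j` by `e_k ∧ e_l`. -/
lemma extInner_quartic_eB {k l : Fin n} (hij : i ≠ j) (hkl : k ≠ l) (hjl : j ≠ l)
    (hi : i ∉ I) (hj : j ∉ I) (hk : k ∉ I) (hl : l ∉ I) :
    extInner (wedgeE k (contrE j (wedgeE l (contrE i (wedgeE i (wedgeE j (eB I)))))))
      (wedgeE k (wedgeE l (eB I))) = -1 := by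
  rw [contrE_wedgeE_wedgeE_eB_left hij hi, contrE_wedgeE_of_ne hjl, contrE_wedgeE_eB hj,
    wedgeE_neg, extInner_neg_left, extInner_wedgeE_left, contrE_wedgeE_wedgeE_eB_left hkl hk,
    extInner_wedgeE_left, contrE_wedgeE_eB hl, extInner_eB_self]

lemma extInner_quartic {k l : Fin n} (hij : i ≠ j) (hik : i ≠ k) (hil : i ≠ l)
    (hjk : j ≠ k) (hjl : j ≠ l) (hkl : k ≠ l)
    (hi : i ∉ I) (hj : j ∉ I) (hk : k ∉ I) (hl : l ∉ I) (a b c d : Fin n) :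
    extInner (wedgeE a (contrE b (wedgeE c (contrE d (wedgeE i (wedgeE j (eB I)))))))
        (wedgeE k (wedgeE l (eB I)))
      = -(((if a = k then 1 else 0) * (if c = l then 1 else 0)
            - (if a = l then 1 else 0) * (if c = k then 1 else 0))
          * ((if b = j then 1 else 0) * (if d = i then 1 else 0)
            - (if b = i then 1 else 0) * (if d = j then 1 else 0))) := by
  have swap (x y : Fin n) : wedgeE x (wedgeE y (eB I)) = -wedgeE y (wedgeE x (eB I)) :=
    wedgeE_wedgeE x y _
  by_cases hI : i ≠ b ∧ i ≠ d
  · rw [extInner_eq_zero_of_wedgeE_contrE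
      (wedgeE_quartic_eq_zero hI.1 hI.2 (wedgeE_wedgeE_wedgeE_self_left _))
      (contrE_wedgeE_wedgeE_eB_of_ne hik hil hi)]
    simp [hI.1.symm, hI.2.symm]
  by_cases hJ : j ≠ b ∧ j ≠ d
  · rw [extInner_eq_zero_of_wedgeE_contrE
      (wedgeE_quartic_eq_zero hJ.1 hJ.2 (wedgeE_wedgeE_wedgeE_self_right _))
      (contrE_wedgeE_wedgeE_eB_of_ne hjk hjl hj)]
    simp [hJ.1.symm, hJ.2.symm]
  by_cases hK : k ≠ a ∧ k ≠ c
  · rw [extInner_comm, extInner_eq_zero_of_wedgeE_contrE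
      (wedgeE_wedgeE_wedgeE_self_left _)
      (contrE_quartic_eq_zero hK.1 hK.2 (contrE_wedgeE_wedgeE_eB_of_ne hik.symm hjk.symm hk))]
    simp [hK.1.symm, hK.2.symm]
  by_cases hL : l ≠ a ∧ l ≠ c
  · rw [extInner_comm, extInner_eq_zero_of_wedgeE_contrE
      (wedgeE_wedgeE_wedgeE_self_right _)
      (contrE_quartic_eq_zero hL.1 hL.2 (contrE_wedgeE_wedgeE_eB_of_ne hil.symm hjl.symm hl))]
    simp [hL.1.symm, hL.2.symm]
  have hbd : (b = j ∧ d = i) ∨ (b = i ∧ d = j) := by grind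
  have hac : (a = k ∧ c = l) ∨ (a = l ∧ c = k) := by grind
  rcases hbd with ⟨rfl, rfl⟩ | ⟨rfl, rfl⟩ <;> rcases hac with ⟨rfl, rfl⟩ | ⟨rfl, rfl⟩
  · rw [extInner_quartic_eB hij hkl hjl hi hj hk hl]
    simp [hij, hij.symm, hkl, hkl.symm]
  · rw [swap c a, extInner_comm, extInner_neg_left, extInner_comm,
      extInner_quartic_eB hij hkl.symm hjk hi hj hl hk]
    simp [hij, hij.symm, hkl, hkl.symm]
  · rw [swap b d]
    simp only [contrE_neg, wedgeE_neg, extInner_neg_left]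
    rw [extInner_quartic_eB hij.symm hkl hil hj hi hk hl]
    simp [hij, hij.symm, hkl, hkl.symm]
  · rw [swap b d, swap c a, extInner_comm, extInner_neg_left, extInner_comm]
    simp only [contrE_neg, wedgeE_neg, extInner_neg_left]
    rw [extInner_quartic_eB hij.symm hkl.symm hik hj hi hl hk]
    simp [hij, hij.symm, hkl, hkl.symm]

end CanonicalAnticommutation

/-- Lemma 3.1(ii). `⟨R^p(e_i ∧ e_j ∧ e^I), e_k ∧ e_l ∧ e^I⟩ = 2·R_{ijkl}`
for distinct `i,j,k,l ∉ I`, `|I| = p − 2`. -/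
theorem statement3 (n p : ℕ) (hp2 : 2 ≤ p) (hpn : p ≤ n)
    (R : AlgCurv (EuclideanSpace ℝ (Fin n)))
    (I : Finset (Fin n)) (hI : I.card + 2 = p)
    (i j k l : Fin n)
    (hij : i ≠ j) (hik : i ≠ k) (hil : i ≠ l)
    (hjk : j ≠ k) (hjl : j ≠ l) (hkl : k ≠ l)
    (hiI : i ∉ I) (hjI : j ∉ I) (hkI : k ∉ I) (hlI : l ∉ I) :
    extInner (weitz R (wedgeE i (wedgeE j (eB I)))) (wedgeE k (wedgeE l (eB I)))
      = 2 * R.T (estd i) (estd j) (estd k) (estd l) := by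
  simp only [weitz, weitzOp, extInner_sum_left, extInner_smul_left,
    extInner_quartic hij hik hil hjk hjl hkl hiI hjI hkI hlI]
  have expand (r x y z w s t u v : ℝ) : r * -((x * y - z * w) * (s * t - u * v))
      = x * (u * (y * (v * r))) - x * (s * (y * (t * r)))
        + z * (s * (w * (t * r))) - z * (u * (w * (v * r))) := by ring
  simp only [expand, Finset.sum_add_distrib, Finset.sum_sub_distrib, ← Finset.mul_sum]
  simp only [ite_mul, one_mul, zero_mul, Finset.sum_ite_eq', Finset.mem_univ, if_true]
  linarith [R.bianchi (estd i) (estd j) (estd k) (estd l),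
    R.antisym₁ (estd k) (estd i) (estd l) (estd j),
    R.antisym₁ (estd k) (estd i) (estd j) (estd l),
    R.antisym₂ (estd k) (estd i) (estd j) (estd l),
    R.pairsym (estd l) (estd j) (estd k) (estd i),
    R.pairsym (estd l) (estd i) (estd k) (estd j),
    R.antisym₁ (estd k) (estd j) (estd l) (estd i),
    R.antisym₂ (estd j) (estd k) (estd l) (estd i)]

end
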